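/- There exists a universal constant C > 0 such that the following holds (Case IVa). Let n ≥ 3, t > 0, r ∈ (1/4,1/2], p = 2(1−r) (so p ∈ (1,3/2)), assume (1−2r)·ln n ≥ e, and let X be a random vector in ℝ^n with the standard normal distribution. Define β_i = (1−2r)^p·(ln n)·n^{-(1-2r)}·i^{-2r}·(ln(n/i))^{p-1} + i^{-1} for integers 1 ≤ i ≤ n/e, and |x|_♯ = ∑_{1≤i≤n/e} β_i^{-(3-2p)/(2(p-1))}·i^{-r/(p-1)}·x_[i]. Then: (i) the coefficient β_i^{-(3-2p)/(2(p-1))}·i^{-r/(p-1)} is non-increasing in i for 1 ≤ i ≤ n/e (so |·|_♯ is a norm on ℝ^n); (ii) for every x ∈ ℝ^n, ∑_{i=1}^{n} i^{-2r}·x_[i]^{2(p-1)} ≤ C·(ln n)^{3-2p}·|x|_♯^{2(p-1)}; (iii) with probability at least 1 − C·exp(−t²/2), |X|_♯ ≤ C^{1/(p-1)}·(1−2r)^{-p/(2(p-1))}·(ln n)^{-(3-2p)/(2(p-1))}·n^{1/2} + C^{1/(p-1)}·(ln n)^{1/2}·t, and consequently ∑_{i=1}^{n} i^{-2r}·X_[i]^{2(p-1)}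 ≤ C·(1−2r)^{-1}·n^{1-2r} + C·(ln n)^{2-p}·t^{2(p-1)}. -/

import Mathlib

open MeasureTheory ProbabilityTheory

/-- `decRe x` is the non-increasing rearrangement of `(|x_1|, …, |x_n|)`
(indexed from `0`, so `decRe x i = x_[i+1]` in the paper's notation). -/
noncomputable def decRe {n : ℕ} (x : Fin n → ℝ) : Fin n → ℝ :=
  fun i => |x (Tuple.sort (fun j => |x j|) i.rev)|

/-- The standard Gaussian measure `N(0, I_n)` on `ℝ^n`. -/
noncomputable def stdGaussian (n : ℕ) : Measure (Fin n → ℝ) :=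
  Measure.pi fun _ => gaussianReal 0 1

/-- The indices `1 ≤ i ≤ n/e` (as a subset of `Fin n`, indexed from `0`). -/
noncomputable def overE (n : ℕ) : Finset (Fin n) :=
  Finset.univ.filter fun i : Fin n => ((i : ℝ) + 1) ≤ (n : ℝ) / Real.exp 1

/-- `β_i = (1-2r)^p (ln n) n^{-(1-2r)} i^{-2r} (ln(n/i))^{p-1} + i^{-1}`
(here `i : Fin n` indexes from `0`, i.e. `betaIV n r p i` is `β_{i+1}`). -/
noncomputable def betaIV (n : ℕ) (r p : ℝ) (i : Fin n) : ℝ :=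
  (1 - 2 * r) ^ p * Real.log n * (n : ℝ) ^ (-(1 - 2 * r)) *
    ((i : ℝ) + 1) ^ (-(2 * r)) * Real.log ((n : ℝ) / ((i : ℝ) + 1)) ^ (p - 1) +
  ((i : ℝ) + 1) ^ (-(1 : ℝ))

/-- The coefficient `β_i^{-(3-2p)/(2(p-1))} i^{-r/(p-1)}`. -/
noncomputable def coeffIV (n : ℕ) (r p : ℝ) (i : Fin n) : ℝ :=
  betaIV n r p i ^ (-(3 - 2 * p) / (2 * (p - 1))) * ((i : ℝ) + 1) ^ (-r / (p - 1))

/-- `|x|_♯ = ∑_{1 ≤ i ≤ n/e} β_i^{-(3-2p)/(2(p-1))} i^{-r/(p-1)} x_[i]`. -/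
noncomputable def sharpIV (n : ℕ) (r p : ℝ) (x : Fin n → ℝ) : ℝ :=
  ∑ i ∈ overE n, coeffIV n r p i * decRe x i

lemma integral_exp_sq_div_four_gaussianReal :
    ∫ x, Real.exp (x ^ 2 / 4) ∂(gaussianReal 0 1) = √2 := by
  rw [integral_gaussianReal_eq_integral_smul one_ne_zero]
  have h (x : ℝ) : gaussianPDFReal 0 1 x • Real.exp (x ^ 2 / 4) =
      (√(2 * Real.pi))⁻¹ * Real.exp (-(1 / 4) * x ^ 2) := by
    simp only [gaussianPDFReal, smul_eq_mul, NNReal.coe_one, mul_one, sub_zero]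
    rw [mul_assoc, ← Real.exp_add]
    congr 2
    ring
  simp_rw [h]
  rw [integral_const_mul, integral_gaussian, inv_mul_eq_div, ← Real.sqrt_div (by positivity)]
  congr 1
  field_simp
  norm_num

lemma integrable_exp_sq_div_four_gaussianReal :
    Integrable (fun x => Real.exp (x ^ 2 / 4)) (gaussianReal 0 1) := by
  refine Integrable.of_integral_ne_zero ?_
  rw [integral_exp_sq_div_four_gaussianReal]
  positivity

lemma exp_subset_sum_eq_prod {n : ℕ} (S : Finset (Fin n)) (x : Fin n → ℝ) :
    Real.exp (∑ j ∈ S, x j ^ 2 / 4) =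
      ∏ j, (if j ∈ S then fun y : ℝ => Real.exp (y ^ 2 / 4) else fun _ => 1) (x j) := by
  have h (j : Fin n) : (if j ∈ S then fun y : ℝ => Real.exp (y ^ 2 / 4) else fun _ => 1) (x j) =
      if j ∈ S then Real.exp (x j ^ 2 / 4) else 1 := by
    split_ifs <;> rfl
  rw [Real.exp_sum, Finset.prod_congr rfl fun j _ => h j]
  simp

lemma integrable_exp_subset_sum {n : ℕ} (S : Finset (Fin n)) :
    Integrable (fun x : Fin n → ℝ => Real.exp (∑ j ∈ S, x j ^ 2 / 4)) (stdGaussian n) := by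
  simp_rw [exp_subset_sum_eq_prod]
  refine Integrable.fintype_prod fun j => ?_
  split_ifs
  · exact integrable_exp_sq_div_four_gaussianReal
  · exact integrable_const _

lemma integral_exp_subset_sum {n : ℕ} (S : Finset (Fin n)) :
    ∫ x : Fin n → ℝ, Real.exp (∑ j ∈ S, x j ^ 2 / 4) ∂(stdGaussian n) = √2 ^ S.card := by
  simp_rw [exp_subset_sum_eq_prod]
  rw [_root_.stdGaussian, integral_fintype_prod_eq_prod (fun j =>
    (if j ∈ S then fun y : ℝ => Real.exp (y ^ 2 / 4) else fun _ => 1))]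
  have h (j : Fin n) : ∫ y, (if j ∈ S then fun y : ℝ => Real.exp (y ^ 2 / 4) else fun _ => 1) y
      ∂(gaussianReal 0 1) = if j ∈ S then √2 else 1 := by
    split_ifs
    · exact integral_exp_sq_div_four_gaussianReal
    · simp
  rw [Finset.prod_congr rfl fun j _ => h j]
  simp

instance isProbabilityMeasure_stdGaussian (n : ℕ) : IsProbabilityMeasure (stdGaussian n) := by
  unfold _root_.stdGaussian
  infer_instance

/-- With high probability all partial sums of squares of a Gaussian vector are controlled. -/
lemma stdGaussian_subset_sums (n : ℕ) (t : ℝ) :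
    1 - 2 * Real.exp (-t ^ 2 / 2) ≤ (stdGaussian n).real {x | ∀ S : Finset (Fin n),
      ∑ j ∈ S, x j ^ 2 ≤ 2 * t ^ 2 + 4 * Real.log (n.choose S.card * 4 ^ S.card)} := by
  set T := {x : Fin n → ℝ | ∀ S : Finset (Fin n),
      ∑ j ∈ S, x j ^ 2 ≤ 2 * t ^ 2 + 4 * Real.log (n.choose S.card * 4 ^ S.card)}
  let w : ℕ → ℝ := fun m => ((n.choose m : ℝ) * 4 ^ m)⁻¹
  have hchoose (S : Finset (Fin n)) : 0 < (n.choose S.card : ℝ) := by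
    have := S.card_le_univ
    rw [Fintype.card_fin] at this
    exact_mod_cast Nat.choose_pos this
  let F : (Fin n → ℝ) → ℝ := fun x =>
    ∑ S : Finset (Fin n), w S.card * Real.exp (∑ j ∈ S, x j ^ 2 / 4)
  have hF_nonneg (x : Fin n → ℝ) : 0 ≤ F x :=
    Finset.sum_nonneg fun S _ => by positivity
  have hF_int : Integrable F (stdGaussian n) :=
    integrable_finsetSum _ fun S _ => (integrable_exp_subset_sum S).const_mul _
  have hF : ∫ x, F x ∂(stdGaussian n) ≤ 2 := by
    have h1 : ∫ x, F x ∂(stdGaussian n) =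
        ∑ S ∈ (Finset.univ : Finset (Fin n)).powerset, w S.card * √2 ^ S.card := by
      rw [Finset.powerset_univ, integral_finsetSum _
        fun S _ => (integrable_exp_subset_sum S).const_mul _]
      simp_rw [integral_const_mul, integral_exp_subset_sum]
    rw [h1, Finset.sum_powerset_apply_card (fun m => w m * √2 ^ m)]
    calc _ ≤ ∑ m ∈ Finset.range (n + 1), (1 / 2 : ℝ) ^ m := by
          rw [Finset.card_univ, Fintype.card_fin]
          refine Finset.sum_le_sum fun m hm => ?_
          have hm' : 0 < (n.choose m : ℝ) := by
            exact_mod_cast Nat.choose_pos (by simpa [Nat.lt_succ_iff] using hm)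
          have h2 : n.choose m • (w m * √2 ^ m) = (√2 / 4) ^ m := by
            simp only [w, nsmul_eq_mul, div_pow]
            field_simp
          rw [h2]
          refine pow_le_pow_left₀ (by positivity) ?_ m
          have : √2 ≤ 2 := Real.sqrt_le_iff.mpr (by norm_num)
          linarith
      _ ≤ 2 := sum_geometric_two_le _
  have hmarkov := mul_meas_ge_le_integral_of_nonneg (ae_of_all _ hF_nonneg) hF_int
    (Real.exp (t ^ 2 / 2))
  have hcover : (Set.univ : Set (Fin n → ℝ)) ⊆ T ∪ {x | Real.exp (t ^ 2 / 2) ≤ F x} := by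
    intro x _
    by_cases hx : Real.exp (t ^ 2 / 2) ≤ F x
    · exact Or.inr hx
    · refine Or.inl fun S => ?_
      push Not at hx
      have hpos : 0 < (n.choose S.card : ℝ) * 4 ^ S.card := by
        have := hchoose S
        positivity
      have h1 : w S.card * Real.exp (∑ j ∈ S, x j ^ 2 / 4) ≤ F x :=
        Finset.single_le_sum (f := fun S : Finset (Fin n) =>
          w S.card * Real.exp (∑ j ∈ S, x j ^ 2 / 4))
          (fun S _ => by positivity) (Finset.mem_univ S)
      have h2 : Real.exp (∑ j ∈ S, x j ^ 2 / 4) ≤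
          Real.exp (t ^ 2 / 2) * (n.choose S.card * 4 ^ S.card) := by
        have h3 := h1.trans hx.le
        simp only [w] at h3
        rwa [inv_mul_eq_div, div_le_iff₀ hpos] at h3
      have h3 := Real.log_le_log (Real.exp_pos _) h2
      rw [Real.log_exp, Real.log_mul (Real.exp_pos _).ne' hpos.ne', Real.log_exp,
        ← Finset.sum_div] at h3
      linarith
  have h1 : (1 : ℝ) ≤ (stdGaussian n).real T +
      (stdGaussian n).real {x | Real.exp (t ^ 2 / 2) ≤ F x} := by
    calc (1 : ℝ) = (stdGaussian n).real Set.univ := by simp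
      _ ≤ _ := (measureReal_mono hcover).trans (measureReal_union_le _ _)
  have h2 : (stdGaussian n).real {x | Real.exp (t ^ 2 / 2) ≤ F x} ≤
      2 * Real.exp (-t ^ 2 / 2) := by
    rw [neg_div, Real.exp_neg, ← div_eq_mul_inv, le_div_iff₀ (Real.exp_pos _), mul_comm]
    exact hmarkov.trans hF
  linarith

lemma log_choose_mul_four_pow_le {n m : ℕ} (hm : 1 ≤ m) (hmn : m ≤ n)
    (hlog : 1 ≤ Real.log (n / m)) :
    Real.log (n.choose m * 4 ^ m) ≤ 4 * m * Real.log (n / m) := by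
  have hm0 : (0 : ℝ) < m := by exact_mod_cast hm
  have hn0 : (0 : ℝ) < n := by exact_mod_cast hm.trans hmn
  have hc : 0 < (n.choose m : ℝ) := by exact_mod_cast Nat.choose_pos hmn
  have h1 : (n.choose m : ℝ) ≤ (n / m * Real.exp 1) ^ m := by
    calc (n.choose m : ℝ) ≤ n ^ m / m.factorial := Nat.choose_le_pow_div m n
      _ = (n / m) ^ m * (m ^ m / m.factorial) := by
          rw [div_pow]
          field_simp
      _ ≤ (n / m) ^ m * Real.exp m := by
          gcongr
          exact Real.pow_div_factorial_le_exp _ hm0.le _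
      _ = _ := by rw [mul_pow, ← Real.exp_nat_mul, mul_one]
  have h4 : Real.log 4 ≤ 2 := by
    have : (4 : ℝ) = 2 ^ 2 := by norm_num
    rw [this, Real.log_pow]
    have := Real.log_two_lt_d9
    push_cast
    linarith
  calc Real.log (n.choose m * 4 ^ m) ≤ Real.log ((n / m * Real.exp 1 * 4) ^ m) := by
        rw [mul_pow _ (4 : ℝ)]
        gcongr
    _ = m * (Real.log (n / m) + 1 + Real.log 4) := by
        rw [Real.log_pow, Real.log_mul (by positivity) (by positivity),
          Real.log_mul (by positivity) (by positivity), Real.log_exp]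
    _ ≤ m * (4 * Real.log (n / m)) := by gcongr; linarith
    _ = _ := by ring

lemma antitone_decRe {n : ℕ} (x : Fin n → ℝ) : Antitone (decRe x) := fun _ _ hij =>
  Tuple.monotone_sort (fun j => |x j|) (Fin.rev_le_rev.mpr hij)

lemma decRe_nonneg {n : ℕ} (x : Fin n → ℝ) (i : Fin n) : 0 ≤ decRe x i := abs_nonneg _

lemma sum_sq_decRe_eq {n : ℕ} (x : Fin n → ℝ) (A : Finset (Fin n)) :
    ∃ S : Finset (Fin n), S.card = A.card ∧ ∑ i ∈ A, decRe x i ^ 2 = ∑ j ∈ S, x j ^ 2 := by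
  refine ⟨A.map (Fin.revPerm.trans (Tuple.sort fun j => |x j|)).toEmbedding, by simp, ?_⟩
  simp [decRe]

lemma sum_range_rpow_sub_one_le {b : ℝ} (hb : 0 < b) (hb1 : b ≤ 1) (n : ℕ) :
    ∑ i ∈ Finset.range n, ((i : ℝ) + 1) ^ (b - 1) ≤ (n : ℝ) ^ b / b := by
  induction n with
  | zero => simp [hb.ne']
  | succ n ih =>
    rw [Finset.sum_range_succ]
    have hn : (0 : ℝ) < (n : ℝ) + 1 := by positivity
    have hinv : ((n : ℝ) + 1)⁻¹ ≤ 1 := inv_le_one_of_one_le₀ (by linarith [n.cast_nonneg (α := ℝ)])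
    have h1 : (1 + -((n : ℝ) + 1)⁻¹) ^ b ≤ 1 + b * -((n : ℝ) + 1)⁻¹ :=
      rpow_one_add_le_one_add_mul_self (by linarith) hb.le hb1
    have h2 : (n : ℝ) ^ b = ((n : ℝ) + 1) ^ b * (1 + -((n : ℝ) + 1)⁻¹) ^ b := by
      rw [← Real.mul_rpow hn.le (by linarith)]
      congr 1
      field_simp
      ring
    have h3 : (n : ℝ) ^ b ≤ ((n : ℝ) + 1) ^ b * (1 + b * -((n : ℝ) + 1)⁻¹) := by
      rw [h2]
      gcongr
    rw [Real.rpow_sub_one hn.ne']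
    push_cast
    calc _ ≤ (n : ℝ) ^ b / b + ((n : ℝ) + 1) ^ b / (n + 1) := by gcongr
      _ ≤ ((n : ℝ) + 1) ^ b * (1 + b * -((n : ℝ) + 1)⁻¹) / b + ((n : ℝ) + 1) ^ b / (n + 1) := by
          gcongr
      _ = _ := by
          field_simp
          ring

lemma sum_inv_le (n : ℕ) : ∑ i : Fin n, ((i : ℝ) + 1)⁻¹ ≤ 1 + Real.log n := by
  have h := harmonic_le_one_add_log n
  rw [harmonic] at h
  push_cast at h
  rwa [Fin.sum_univ_eq_sum_range (fun i : ℕ => ((i : ℝ) + 1)⁻¹) n]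

lemma one_le_log_div {x k : ℝ} (hk : 0 < k) (h : k ≤ x / Real.exp 1) :
    1 ≤ Real.log (x / k) := by
  have hx : Real.exp 1 * k ≤ x := by
    rwa [le_div_iff₀ (Real.exp_pos 1), mul_comm] at h
  rw [Real.le_log_iff_exp_le (div_pos ((mul_pos (Real.exp_pos 1) hk).trans_le hx) hk),
    le_div_iff₀ hk]
  exact hx

lemma one_le_log_of_mem_overE {n : ℕ} {i : Fin n} (hi : i ∈ overE n) :
    1 ≤ Real.log (n / ((i : ℝ) + 1)) :=
  one_le_log_div (by positivity) (by simpa [overE] using hi)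

lemma mul_log_div_le {x k l : ℝ} (hx : 0 < x) (hk : 0 < k) (hkl : k ≤ l)
    (hl : 1 ≤ Real.log (x / l)) : k * Real.log (x / k) ≤ l * Real.log (x / l) := by
  have hl0 : 0 < l := hk.trans_le hkl
  have h1 : Real.log (x / k) = Real.log (x / l) + Real.log (l / k) := by
    rw [← Real.log_mul (by positivity) (by positivity)]
    congr 1
    field_simp
  have h2 : Real.log (l / k) ≤ l / k - 1 := Real.log_le_sub_one_of_pos (by positivity)
  have h3 : k * Real.log (l / k) ≤ l - k := by
    calc _ ≤ k * (l / k - 1) := by gcongr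
      _ = l - k := by field_simp
  rw [h1]
  nlinarith

lemma rpow_mul_log_rpow_le {a x k : ℝ} (ha : 0 < a) (ha1 : a ≤ 1) (hx : 0 < x) (hk : 0 < k)
    (hl : 0 ≤ Real.log (x / k)) :
    a ^ (1 + a) * (k ^ (a - 1) * Real.log (x / k) ^ a) ≤
      2 * a * x ^ (a / 2) * k ^ (a / 2 - 1) := by
  set l := Real.log (x / k) with hl_def
  have h1 : (a * l) ^ a ≤ 2 * (x / k) ^ (a / 2) := by
    have hal : 0 ≤ a * l := by positivity
    calc (a * l) ^ a ≤ 1 + a * l := by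
          rcases le_total (a * l) 1 with h | h
          · linarith [Real.rpow_le_one hal h ha.le]
          · have := Real.rpow_le_rpow_of_exponent_le h ha1
            rw [Real.rpow_one] at this
            linarith
      _ ≤ 2 * (l * (a / 2) + 1) := by linarith
      _ ≤ 2 * Real.exp (l * (a / 2)) := by gcongr; exact Real.add_one_le_exp _
      _ = _ := by rw [hl_def, ← Real.rpow_def_of_pos (by positivity)]
  have h2 : k ^ (a / 2 - 1) = k ^ (a - 1) / k ^ (a / 2) := by
    rw [← Real.rpow_sub hk]
    congr 1
    ring
  calc a ^ (1 + a) * (k ^ (a - 1) * l ^ a) = a * k ^ (a - 1) * (a * l) ^ a := by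
        rw [Real.rpow_add ha, Real.rpow_one, Real.mul_rpow ha.le hl]
        ring
    _ ≤ a * k ^ (a - 1) * (2 * (x / k) ^ (a / 2)) := by gcongr
    _ = _ := by
        rw [h2, Real.div_rpow hx.le hk.le]
        ring

lemma sum_overE_rpow_mul_log_le {a : ℝ} (ha : 0 < a) (ha1 : a ≤ 1) (n : ℕ) :
    a ^ (1 + a) * ∑ i ∈ overE n,
      ((i : ℝ) + 1) ^ (a - 1) * Real.log (n / ((i : ℝ) + 1)) ^ a ≤ 4 * (n : ℝ) ^ a := by
  rcases n.eq_zero_or_pos with rfl | hn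
  · simp [ha.ne']
  have hn0 : (0 : ℝ) < n := by exact_mod_cast hn
  rw [Finset.mul_sum]
  calc _ ≤ ∑ i ∈ overE n, 2 * a * (n : ℝ) ^ (a / 2) * ((i : ℝ) + 1) ^ (a / 2 - 1) :=
        Finset.sum_le_sum fun i hi => rpow_mul_log_rpow_le ha ha1 hn0 (by positivity)
          (zero_le_one.trans (one_le_log_of_mem_overE hi))
    _ ≤ ∑ i : Fin n, 2 * a * (n : ℝ) ^ (a / 2) * ((i : ℝ) + 1) ^ (a / 2 - 1) :=
        Finset.sum_le_sum_of_subset_of_nonneg (Finset.subset_univ _)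
          fun i _ _ => by positivity
    _ = 2 * a * (n : ℝ) ^ (a / 2) * ∑ i ∈ Finset.range n, ((i : ℝ) + 1) ^ (a / 2 - 1) := by
        rw [← Finset.mul_sum, Fin.sum_univ_eq_sum_range (fun i : ℕ => ((i : ℝ) + 1) ^ (a / 2 - 1)) n]
    _ ≤ 2 * a * (n : ℝ) ^ (a / 2) * ((n : ℝ) ^ (a / 2) / (a / 2)) := by
        gcongr
        exact sum_range_rpow_sub_one_le (by positivity) (by linarith) n
    _ = 4 * ((n : ℝ) ^ (a / 2) * (n : ℝ) ^ (a / 2)) := by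
        field_simp
        ring
    _ = _ := by
        rw [← Real.rpow_add hn0]
        congr 2
        ring

/-- The normalised coefficient `i β_i`, written in terms of `a = 1 - 2r`. -/
noncomputable def scaledBeta (n : ℕ) (a : ℝ) (i : Fin n) : ℝ :=
  a ^ (1 + a) * Real.log n * (n : ℝ) ^ (-a) *
    (((i : ℝ) + 1) * Real.log (n / ((i : ℝ) + 1))) ^ a + 1

lemma rpow_mul_log_nonneg {n : ℕ} {i : Fin n} {a : ℝ} (ha : 0 < a) (hi : i ∈ overE n) :
    0 ≤ a ^ (1 + a) * Real.log n * (n : ℝ) ^ (-a) *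
      (((i : ℝ) + 1) * Real.log (n / ((i : ℝ) + 1))) ^ a := by
  have h := one_le_log_of_mem_overE hi
  have := Real.log_natCast_nonneg n
  have : 0 ≤ Real.log (n / ((i : ℝ) + 1)) := by linarith
  positivity

lemma one_le_scaledBeta {n : ℕ} {i : Fin n} {a : ℝ} (ha : 0 < a) (hi : i ∈ overE n) :
    1 ≤ scaledBeta n a i := by
  have := rpow_mul_log_nonneg ha hi
  unfold scaledBeta
  linarith

lemma betaIV_eq {n : ℕ} {i : Fin n} {a : ℝ} (hi : i ∈ overE n) :
    betaIV n ((1 - a) / 2) (1 + a) i = scaledBeta n a i / ((i : ℝ) + 1) := by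
  have hl := one_le_log_of_mem_overE hi
  have hk : (0 : ℝ) < (i : ℝ) + 1 := by positivity
  have h1 : 1 - 2 * ((1 - a) / 2) = a := by ring
  have h2 : -(2 * ((1 - a) / 2)) = a - 1 := by ring
  have h3 : 1 + a - 1 = a := by ring
  rw [betaIV, h1, h2, h3, scaledBeta, Real.mul_rpow hk.le (by linarith), Real.rpow_sub_one hk.ne',
    Real.rpow_neg_one]
  ring

lemma coeffIV_eq {n : ℕ} {i : Fin n} {a : ℝ} (ha : 0 < a) (hi : i ∈ overE n) :
    coeffIV n ((1 - a) / 2) (1 + a) i =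
      ((i : ℝ) + 1) ^ (-(1 / 2) : ℝ) * scaledBeta n a i ^ (-((1 - 2 * a) / (2 * a))) := by
  have hk : (0 : ℝ) < (i : ℝ) + 1 := by positivity
  have hs : 0 ≤ scaledBeta n a i := zero_le_one.trans (one_le_scaledBeta ha hi)
  have h1 : -(3 - 2 * (1 + a)) / (2 * (1 + a - 1)) = -((1 - 2 * a) / (2 * a)) := by
    rw [neg_div]
    congr 2 <;> ring
  have h2 : -((1 - a) / 2) / (1 + a - 1) = -(1 / 2) + -((1 - 2 * a) / (2 * a)) := by
    rw [show 1 + a - 1 = a by ring]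
    field_simp
    ring
  rw [coeffIV, betaIV_eq hi, h1, h2, Real.rpow_add hk, Real.div_rpow hs hk.le]
  have : ((i : ℝ) + 1) ^ (-((1 - 2 * a) / (2 * a))) ≠ 0 := (Real.rpow_pos_of_pos hk _).ne'
  field_simp

lemma coeffIV_nonneg {n : ℕ} {i : Fin n} {a : ℝ} (ha : 0 < a) (hi : i ∈ overE n) :
    0 ≤ coeffIV n ((1 - a) / 2) (1 + a) i := by
  have := one_le_scaledBeta ha hi
  rw [coeffIV_eq ha hi]
  positivity

lemma coeffIV_antitone {n : ℕ} {i j : Fin n} {a : ℝ} (ha : 0 < a) (ha2 : a < 1 / 2) (hij : i ≤ j)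
    (hi : i ∈ overE n) (hj : j ∈ overE n) :
    coeffIV n ((1 - a) / 2) (1 + a) j ≤ coeffIV n ((1 - a) / 2) (1 + a) i := by
  have hn0 : (0 : ℝ) < n := by exact_mod_cast i.pos
  have hk : (0 : ℝ) < (i : ℝ) + 1 := by positivity
  have hij' : (i : ℝ) + 1 ≤ (j : ℝ) + 1 := by
    have : (i : ℕ) ≤ j := hij
    gcongr
  have hl := one_le_log_of_mem_overE hi
  have hL := Real.log_natCast_nonneg n
  have h1 := one_le_scaledBeta ha hi
  have h2 := one_le_scaledBeta ha hj
  have hs : 0 ≤ (1 - 2 * a) / (2 * a) := div_nonneg (by linarith) (by linarith)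
  have h3 : scaledBeta n a i ≤ scaledBeta n a j := by
    have hkl : 0 ≤ ((i : ℝ) + 1) * Real.log (n / ((i : ℝ) + 1)) :=
      mul_nonneg hk.le (zero_le_one.trans hl)
    have hle := mul_log_div_le hn0 hk hij' (one_le_log_of_mem_overE hj)
    unfold scaledBeta
    gcongr
  rw [coeffIV_eq ha hi, coeffIV_eq ha hj]
  refine mul_le_mul (Real.rpow_le_rpow_of_nonpos hk hij' (by norm_num))
    (Real.rpow_le_rpow_of_nonpos (by linarith) h3 (by linarith)) (by positivity) (by positivity)

lemma sum_coeffIV_sq_le {n : ℕ} {a : ℝ} (ha : 0 < a) (ha2 : a < 1 / 2) :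
    ∑ i ∈ overE n, coeffIV n ((1 - a) / 2) (1 + a) i ^ 2 ≤ 1 + Real.log n := by
  calc _ ≤ ∑ i ∈ overE n, ((i : ℝ) + 1)⁻¹ := by
        refine Finset.sum_le_sum fun i hi => ?_
        have hk : (0 : ℝ) < (i : ℝ) + 1 := by positivity
        have h1 := one_le_scaledBeta ha hi
        have hs : 0 ≤ (1 - 2 * a) / (2 * a) := div_nonneg (by linarith) (by linarith)
        have h2 : coeffIV n ((1 - a) / 2) (1 + a) i ≤ ((i : ℝ) + 1) ^ (-(1 / 2) : ℝ) := by
          rw [coeffIV_eq ha hi]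
          exact mul_le_of_le_one_right (by positivity)
            (Real.rpow_le_one_of_one_le_of_nonpos h1 (by linarith))
        calc _ ≤ (((i : ℝ) + 1) ^ (-(1 / 2) : ℝ)) ^ 2 :=
              pow_le_pow_left₀ (coeffIV_nonneg ha hi) h2 2
          _ = _ := by
              rw [← Real.rpow_natCast, ← Real.rpow_mul hk.le, ← Real.rpow_neg_one]
              norm_num
    _ ≤ ∑ i : Fin n, ((i : ℝ) + 1)⁻¹ :=
        Finset.sum_le_sum_of_subset_of_nonneg (Finset.subset_univ _)
          fun i _ _ => by positivity
    _ ≤ _ := sum_inv_le n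

lemma sum_coeffIV_mul_sqrt_log_le {n : ℕ} {a : ℝ} (ha : 0 < a) (ha2 : a < 1 / 2)
    (hL : 0 < Real.log n) :
    ∑ i ∈ overE n, coeffIV n ((1 - a) / 2) (1 + a) i * √(Real.log (n / ((i : ℝ) + 1))) ≤
      4 * (a ^ (-(1 + a) / (2 * a)) * Real.log n ^ (-((1 - 2 * a) / (2 * a))) *
        (n : ℝ) ^ (1 / 2 : ℝ)) := by
  have hn0 : (0 : ℝ) < n := by
    rcases n.eq_zero_or_pos with rfl | hn
    · simp at hL
    · exact_mod_cast hn
  set s := (1 - 2 * a) / (2 * a) with hs_def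
  have hs : 0 ≤ s := div_nonneg (by linarith) (by linarith)
  have has : a * s = 1 / 2 - a := by
    rw [hs_def]
    field_simp
  set D := a ^ (1 + a) * Real.log n * (n : ℝ) ^ (-a) with hD
  have hD0 : 0 < D := by positivity
  have hterm (i : Fin n) (hi : i ∈ overE n) :
      coeffIV n ((1 - a) / 2) (1 + a) i * √(Real.log (n / ((i : ℝ) + 1))) ≤
        D ^ (-s) * (((i : ℝ) + 1) ^ (a - 1) * Real.log (n / ((i : ℝ) + 1)) ^ a) := by
    have hk : (0 : ℝ) < (i : ℝ) + 1 := by positivity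
    have hl : 0 < Real.log (n / ((i : ℝ) + 1)) := by linarith [one_le_log_of_mem_overE hi]
    set k := (i : ℝ) + 1
    set l := Real.log (n / k)
    rw [coeffIV_eq ha hi, Real.sqrt_eq_rpow]
    have h1 : scaledBeta n a i ^ (-s) ≤ (D * (k * l) ^ a) ^ (-s) := by
      refine Real.rpow_le_rpow_of_nonpos (by positivity) ?_ (by linarith)
      simp only [scaledBeta]
      exact (lt_add_one _).le
    have h2 : (D * (k * l) ^ a) ^ (-s) = D ^ (-s) * (k ^ (a - 1 / 2) * l ^ (a - 1 / 2)) := by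
      rw [Real.mul_rpow hD0.le (by positivity), ← Real.rpow_mul (by positivity),
        ← Real.mul_rpow hk.le hl.le]
      congr 2
      linarith
    calc _ ≤ k ^ (-(1 / 2) : ℝ) * (D * (k * l) ^ a) ^ (-s) * l ^ (1 / 2 : ℝ) := by gcongr
      _ = D ^ (-s) * ((k ^ (-(1 / 2) : ℝ) * k ^ (a - 1 / 2)) *
            (l ^ (a - 1 / 2) * l ^ (1 / 2 : ℝ))) := by
          rw [h2]
          ring
      _ = _ := by
          rw [← Real.rpow_add hk, ← Real.rpow_add hl]
          congr 3 <;> ring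
  have hsum := sum_overE_rpow_mul_log_le ha (by linarith) n
  calc _ ≤ ∑ i ∈ overE n, D ^ (-s) *
          (((i : ℝ) + 1) ^ (a - 1) * Real.log (n / ((i : ℝ) + 1)) ^ a) :=
        Finset.sum_le_sum hterm
    _ = D ^ (-s) * (a ^ (1 + a))⁻¹ * (a ^ (1 + a) * ∑ i ∈ overE n,
          ((i : ℝ) + 1) ^ (a - 1) * Real.log (n / ((i : ℝ) + 1)) ^ a) := by
        rw [← Finset.mul_sum]
        have : a ^ (1 + a) ≠ 0 := by positivity
        field_simp
    _ ≤ D ^ (-s) * (a ^ (1 + a))⁻¹ * (4 * (n : ℝ) ^ a) := by gcongr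
    _ = 4 * ((a ^ ((1 + a) * (-s)) * a ^ (-(1 + a))) * Real.log n ^ (-s) *
          ((n : ℝ) ^ (-a * -s) * (n : ℝ) ^ a)) := by
        rw [hD, Real.mul_rpow (by positivity) (by positivity),
          Real.mul_rpow (by positivity) (by positivity), ← Real.rpow_mul ha.le,
          ← Real.rpow_mul hn0.le, Real.rpow_neg ha.le (1 + a)]
        ring
    _ = _ := by
        rw [← Real.rpow_add ha, ← Real.rpow_add hn0]
        congr 4
        · rw [hs_def]
          field_simp
          ring
        · linarith

lemma sum_betaIV_le {n : ℕ} {a : ℝ} (ha : 0 < a) (ha1 : a ≤ 1) (hL : 1 ≤ Real.log n) :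
    ∑ i ∈ overE n, betaIV n ((1 - a) / 2) (1 + a) i ≤ 6 * Real.log n := by
  have hn0 : (0 : ℝ) < n := by
    rcases n.eq_zero_or_pos with rfl | hn
    · norm_num at hL
    · exact_mod_cast hn
  have h1 : 1 - 2 * ((1 - a) / 2) = a := by ring
  have h2 : -(2 * ((1 - a) / 2)) = a - 1 := by ring
  have h3 : 1 + a - 1 = a := by ring
  have hinv : ∑ i ∈ overE n, ((i : ℝ) + 1)⁻¹ ≤ 1 + Real.log n :=
    (Finset.sum_le_sum_of_subset_of_nonneg (Finset.subset_univ _)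
      fun i _ _ => by positivity).trans (sum_inv_le n)
  have hmain := sum_overE_rpow_mul_log_le ha ha1 n
  calc _ = Real.log n * (n : ℝ) ^ (-a) * (a ^ (1 + a) * ∑ i ∈ overE n,
          ((i : ℝ) + 1) ^ (a - 1) * Real.log (n / ((i : ℝ) + 1)) ^ a) +
          ∑ i ∈ overE n, ((i : ℝ) + 1)⁻¹ := by
        rw [Finset.mul_sum, Finset.mul_sum, ← Finset.sum_add_distrib]
        refine Finset.sum_congr rfl fun i _ => ?_
        rw [betaIV, h1, h2, h3, Real.rpow_neg_one]
        ring
    _ ≤ Real.log n * (n : ℝ) ^ (-a) * (4 * (n : ℝ) ^ a) + (1 + Real.log n) := by gcongr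
    _ = 4 * Real.log n + (1 + Real.log n) := by
        rw [Real.rpow_neg hn0.le]
        have : (n : ℝ) ^ a ≠ 0 := by positivity
        field_simp
    _ ≤ _ := by linarith

lemma div_six_le_card_overE {n : ℕ} (hn : 3 ≤ n) : (n : ℝ) / 6 ≤ (overE n).card := by
  have he : Real.exp 1 < 3 := Real.exp_one_lt_d9.trans (by norm_num)
  have hn3 : (3 : ℝ) ≤ n := by exact_mod_cast hn
  have hone : 1 ≤ (n : ℝ) / Real.exp 1 := by
    rw [le_div_iff₀ (Real.exp_pos 1)]
    linarith
  have hset : overE n = Finset.univ.filter fun i : Fin n => (i : ℕ) < ⌊(n : ℝ) / Real.exp 1⌋₊ := by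
    ext i
    simp only [overE, Finset.mem_filter_univ, ← Nat.succ_le_iff,
      Nat.le_floor_iff (zero_le_one.trans hone)]
    push_cast
    rfl
  have hfloor : ⌊(n : ℝ) / Real.exp 1⌋₊ ≤ n := by
    refine Nat.floor_le_of_le (div_le_self n.cast_nonneg ?_)
    exact Real.one_le_exp zero_le_one
  rw [hset, Fin.card_filter_val_lt, min_eq_right hfloor]
  calc (n : ℝ) / 6 = n / 3 / 2 := by ring
    _ ≤ n / Real.exp 1 / 2 := by gcongr
    _ ≤ _ := (Nat.div_two_lt_floor hone).le

lemma sum_le_seven_mul_sum_overE {n : ℕ} (hn : 3 ≤ n) {f : Fin n → ℝ} (hf : Antitone f)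
    (hf0 : ∀ i, 0 ≤ f i) : ∑ i, f i ≤ 7 * ∑ i ∈ overE n, f i := by
  have hn0 : (0 : ℝ) < n := by
    have : 0 < n := by omega
    exact_mod_cast this
  have hS : 0 ≤ ∑ i ∈ overE n, f i := Finset.sum_nonneg fun i _ => hf0 i
  have hcard := div_six_le_card_overE hn
  have htail (i : Fin n) (hi : i ∈ (overE n)ᶜ) : f i ≤ 6 / n * ∑ i ∈ overE n, f i := by
    have h1 : (overE n).card • f i ≤ ∑ i ∈ overE n, f i := by
      refine Finset.card_nsmul_le_sum _ _ _ fun j hj => hf ?_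
      by_contra! hlt
      have hlt' : (i : ℝ) < j := by exact_mod_cast hlt
      simp only [overE, Finset.mem_compl, Finset.mem_filter_univ] at hi hj
      linarith
    rw [nsmul_eq_mul] at h1
    have h2 : (n : ℝ) / 6 * f i ≤ ∑ i ∈ overE n, f i :=
      (mul_le_mul_of_nonneg_right hcard (hf0 i)).trans h1
    rw [div_mul_eq_mul_div, le_div_iff₀ hn0]
    linarith
  have hsum : ∑ i ∈ (overE n)ᶜ, f i ≤ 6 * ∑ i ∈ overE n, f i := by
    calc _ ≤ (overE n)ᶜ.card • (6 / n * ∑ i ∈ overE n, f i) :=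
          Finset.sum_le_card_nsmul _ _ _ htail
      _ = (overE n)ᶜ.card * (6 / n * ∑ i ∈ overE n, f i) := nsmul_eq_mul _ _
      _ ≤ n * (6 / n * ∑ i ∈ overE n, f i) := by
          gcongr
          simpa using Finset.card_le_univ (overE n)ᶜ
      _ = _ := by field_simp
  rw [← Finset.sum_add_sum_compl (overE n)]
  linarith

lemma sharpIV_nonneg {n : ℕ} {a : ℝ} (ha : 0 < a) (x : Fin n → ℝ) :
    0 ≤ sharpIV n ((1 - a) / 2) (1 + a) x :=
  Finset.sum_nonneg fun i hi => mul_nonneg (coeffIV_nonneg ha hi) (decRe_nonneg x i)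

lemma sum_overE_rpow_mul_decRe_le {n : ℕ} {a : ℝ} (ha : 0 < a) (ha2 : a < 1 / 2)
    (x : Fin n → ℝ) :
    ∑ i ∈ overE n, ((i : ℝ) + 1) ^ (a - 1) * decRe x i ^ (2 * a) ≤
      sharpIV n ((1 - a) / 2) (1 + a) x ^ (2 * a) *
        (∑ i ∈ overE n, betaIV n ((1 - a) / 2) (1 + a) i) ^ (1 - 2 * a) := by
  have hq : 0 < 1 - 2 * a := by linarith
  have hpq : Real.HolderConjugate (2 * a)⁻¹ (1 - 2 * a)⁻¹ := by
    rw [Real.holderConjugate_iff]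
    refine ⟨(one_lt_inv₀ (by positivity)).mpr (by linarith), ?_⟩
    simp
  have hβ (i : Fin n) (hi : i ∈ overE n) : 0 ≤ betaIV n ((1 - a) / 2) (1 + a) i := by
    have := one_le_scaledBeta ha hi
    rw [betaIV_eq hi]
    positivity
  have hcy (i : Fin n) (hi : i ∈ overE n) :
      0 ≤ coeffIV n ((1 - a) / 2) (1 + a) i * decRe x i :=
    mul_nonneg (coeffIV_nonneg ha hi) (decRe_nonneg x i)
  have hterm (i : Fin n) (hi : i ∈ overE n) : ((i : ℝ) + 1) ^ (a - 1) * decRe x i ^ (2 * a) =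
      (coeffIV n ((1 - a) / 2) (1 + a) i * decRe x i) ^ (2 * a) *
        betaIV n ((1 - a) / 2) (1 + a) i ^ (1 - 2 * a) := by
    have hk : (0 : ℝ) < (i : ℝ) + 1 := by positivity
    have hE : 0 < scaledBeta n a i := zero_lt_one.trans_le (one_le_scaledBeta ha hi)
    have hexp : -((1 - 2 * a) / (2 * a)) * (2 * a) = -(1 - 2 * a) := by
      field_simp
    rw [Real.mul_rpow (coeffIV_nonneg ha hi) (decRe_nonneg x i), coeffIV_eq ha hi, betaIV_eq hi,
      Real.mul_rpow (by positivity) (by positivity), Real.div_rpow hE.le hk.le,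
      ← Real.rpow_mul hk.le, ← Real.rpow_mul hE.le, hexp, Real.rpow_neg hE.le,
      show a - 1 = -(1 / 2) * (2 * a) - (1 - 2 * a) by ring, Real.rpow_sub hk]
    have : scaledBeta n a i ^ (1 - 2 * a) ≠ 0 := by positivity
    field_simp
  have hholder := Real.inner_le_Lp_mul_Lq_of_nonneg (overE n) hpq
    (fun i hi => Real.rpow_nonneg (hcy i hi) (2 * a))
    (fun i hi => Real.rpow_nonneg (hβ i hi) (1 - 2 * a))
  rw [Finset.sum_congr rfl hterm]
  refine hholder.trans (le_of_eq ?_)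
  rw [one_div, one_div, inv_inv, inv_inv, sharpIV]
  congr 2
  · exact Finset.sum_congr rfl fun i hi => Real.rpow_rpow_inv (hcy i hi) (by positivity)
  · exact Finset.sum_congr rfl fun i hi => Real.rpow_rpow_inv (hβ i hi) hq.ne'

lemma sum_rpow_mul_decRe_le {n : ℕ} {a : ℝ} (hn : 3 ≤ n) (ha : 0 < a) (ha2 : a < 1 / 2)
    (hL : 1 ≤ Real.log n) (x : Fin n → ℝ) :
    ∑ i : Fin n, ((i : ℝ) + 1) ^ (a - 1) * decRe x i ^ (2 * a) ≤
      42 * Real.log n ^ (1 - 2 * a) * sharpIV n ((1 - a) / 2) (1 + a) x ^ (2 * a) := by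
  have hsharp := sharpIV_nonneg ha x
  have hβ : 0 ≤ ∑ i ∈ overE n, betaIV n ((1 - a) / 2) (1 + a) i := by
    refine Finset.sum_nonneg fun i hi => ?_
    have := one_le_scaledBeta ha hi
    rw [betaIV_eq hi]
    positivity
  have hanti : Antitone fun i : Fin n => ((i : ℝ) + 1) ^ (a - 1) * decRe x i ^ (2 * a) := by
    intro i j hij
    have hij' : (i : ℝ) + 1 ≤ (j : ℝ) + 1 := by
      have : (i : ℕ) ≤ j := hij
      gcongr
    have h1 := decRe_nonneg x j
    exact mul_le_mul (Real.rpow_le_rpow_of_nonpos (by positivity) hij' (by linarith))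
      (Real.rpow_le_rpow h1 (antitone_decRe x hij) (by positivity)) (by positivity)
      (by positivity)
  have hnonneg (i : Fin n) : 0 ≤ ((i : ℝ) + 1) ^ (a - 1) * decRe x i ^ (2 * a) := by
    have := decRe_nonneg x i
    positivity
  calc _ ≤ 7 * ∑ i ∈ overE n, ((i : ℝ) + 1) ^ (a - 1) * decRe x i ^ (2 * a) :=
        sum_le_seven_mul_sum_overE hn hanti hnonneg
    _ ≤ 7 * (sharpIV n ((1 - a) / 2) (1 + a) x ^ (2 * a) * (6 * Real.log n) ^ (1 - 2 * a)) := by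
        refine mul_le_mul_of_nonneg_left
          ((sum_overE_rpow_mul_decRe_le ha ha2 x).trans ?_) (by norm_num)
        gcongr
        · linarith
        · exact sum_betaIV_le ha (by linarith) hL
    _ ≤ 7 * (sharpIV n ((1 - a) / 2) (1 + a) x ^ (2 * a) *
          (6 * Real.log n ^ (1 - 2 * a))) := by
        have h6 : (6 : ℝ) ^ (1 - 2 * a) ≤ 6 := by
          have := Real.rpow_le_rpow_of_exponent_le (x := 6) (by norm_num)
            (show 1 - 2 * a ≤ 1 by linarith)
          rwa [Real.rpow_one] at this
        rw [Real.mul_rpow (by norm_num) (by linarith)]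
        gcongr
    _ = _ := by ring

lemma sum_Iic_decRe_sq_le {n : ℕ} {t : ℝ} {x : Fin n → ℝ}
    (hx : ∀ S : Finset (Fin n),
      ∑ j ∈ S, x j ^ 2 ≤ 2 * t ^ 2 + 4 * Real.log (n.choose S.card * 4 ^ S.card))
    {m : Fin n} (hm : m ∈ overE n) :
    ∑ i ∈ Finset.Iic m, decRe x i ^ 2 ≤
      2 * t ^ 2 + 16 * (((m : ℝ) + 1) * Real.log (n / ((m : ℝ) + 1))) := by
  obtain ⟨S, hS, hsum⟩ := sum_sq_decRe_eq x (Finset.Iic m)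
  rw [Fin.card_Iic] at hS
  have hlog := one_le_log_of_mem_overE hm
  have h := log_choose_mul_four_pow_le (n := n) (m := m + 1) (by omega) m.isLt
    (by push_cast; exact hlog)
  have h2 := hx S
  rw [hS] at h2
  push_cast at h
  rw [hsum]
  linarith

lemma sharpIV_le {n : ℕ} {a t : ℝ} (ha : 0 < a) (ha2 : a < 1 / 2) (hL : 1 ≤ Real.log n)
    (ht : 0 ≤ t) {x : Fin n → ℝ}
    (hx : ∀ S : Finset (Fin n),
      ∑ j ∈ S, x j ^ 2 ≤ 2 * t ^ 2 + 4 * Real.log (n.choose S.card * 4 ^ S.card)) :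
    sharpIV n ((1 - a) / 2) (1 + a) x ≤
      20 * (a ^ (-(1 + a) / (2 * a)) * Real.log n ^ (-((1 - 2 * a) / (2 * a))) *
        (n : ℝ) ^ (1 / 2 : ℝ)) + 10 * (√(Real.log n) * t) := by
  classical
  let B := (overE n).filter fun i : Fin n =>
    18 * Real.log (n / ((i : ℝ) + 1)) < decRe x i ^ 2
  have hB : ∑ i ∈ B, decRe x i ^ 2 ≤ 18 * t ^ 2 := by
    rcases B.eq_empty_or_nonempty with h | h
    · rw [h, Finset.sum_empty]
      positivity
    · set m := B.max' h
      obtain ⟨hmE, hm⟩ := Finset.mem_filter.mp (B.max'_mem h)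
      have hk : (0 : ℝ) < (m : ℝ) + 1 := by positivity
      have h1 : ((m : ℝ) + 1) * decRe x m ^ 2 ≤ ∑ i ∈ Finset.Iic m, decRe x i ^ 2 := by
        have := Finset.card_nsmul_le_sum (Finset.Iic m) (fun i => decRe x i ^ 2) (decRe x m ^ 2)
          fun i hi => pow_le_pow_left₀ (decRe_nonneg x m)
            (antitone_decRe x (Finset.mem_Iic.mp hi)) 2
        rw [nsmul_eq_mul, Fin.card_Iic] at this
        push_cast at this
        exact this
      have h2 := sum_Iic_decRe_sq_le hx hmE
      have h3 := mul_lt_mul_of_pos_left hm hk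
      have h4 : ∑ i ∈ B, decRe x i ^ 2 ≤ ∑ i ∈ Finset.Iic m, decRe x i ^ 2 :=
        Finset.sum_le_sum_of_subset_of_nonneg
          (fun i hi => Finset.mem_Iic.mpr (B.le_max' i hi)) fun i _ _ => sq_nonneg _
      linarith
  have hBsum : ∑ i ∈ B, coeffIV n ((1 - a) / 2) (1 + a) i * decRe x i ≤
      10 * (√(Real.log n) * t) := by
    have hc : ∑ i ∈ B, coeffIV n ((1 - a) / 2) (1 + a) i ^ 2 ≤ 4 * Real.log n := by
      have h1 := Finset.sum_le_sum_of_subset_of_nonneg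
        (f := fun i => coeffIV n ((1 - a) / 2) (1 + a) i ^ 2)
        (Finset.filter_subset _ _ : B ⊆ overE n) fun i _ _ => sq_nonneg _
      have h2 := sum_coeffIV_sq_le (n := n) ha ha2
      linarith
    calc _ ≤ √(∑ i ∈ B, coeffIV n ((1 - a) / 2) (1 + a) i ^ 2) * √(∑ i ∈ B, decRe x i ^ 2) :=
          Real.sum_mul_le_sqrt_mul_sqrt _ _ _
      _ ≤ √(2 ^ 2 * Real.log n) * √((5 * t) ^ 2) := by
          gcongr
          · linarith
          · nlinarith
      _ = _ := by
          rw [Real.sqrt_mul (by norm_num), Real.sqrt_sq (by norm_num),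
            Real.sqrt_sq (by positivity)]
          ring
  have hG : ∑ i ∈ (overE n).filter
        (fun i : Fin n => ¬ 18 * Real.log (n / ((i : ℝ) + 1)) < decRe x i ^ 2),
        coeffIV n ((1 - a) / 2) (1 + a) i * decRe x i ≤
      5 * ∑ i ∈ overE n,
        coeffIV n ((1 - a) / 2) (1 + a) i * √(Real.log (n / ((i : ℝ) + 1))) := by
    rw [Finset.mul_sum]
    refine (Finset.sum_le_sum fun i hi => ?_).trans
      (Finset.sum_le_sum_of_subset_of_nonneg (Finset.filter_subset _ _) fun i hi _ => ?_)
    · obtain ⟨hiE, hi⟩ := Finset.mem_filter.mp hi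
      have hl := one_le_log_of_mem_overE hiE
      have hc := coeffIV_nonneg ha hiE
      have hy : decRe x i ≤ 5 * √(Real.log (n / ((i : ℝ) + 1))) := by
        refine le_of_sq_le_sq ?_ (by positivity)
        rw [mul_pow, Real.sq_sqrt (by linarith)]
        linarith
      calc _ ≤ coeffIV n ((1 - a) / 2) (1 + a) i * (5 * √(Real.log (n / ((i : ℝ) + 1)))) := by
            gcongr
        _ = _ := by ring
    · have hc := coeffIV_nonneg ha hi
      positivity
  have hmean := sum_coeffIV_mul_sqrt_log_le (n := n) ha ha2 (by linarith)
  rw [sharpIV, ← Finset.sum_filter_add_sum_filter_not (overE n)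
    (fun i : Fin n => 18 * Real.log (n / ((i : ℝ) + 1)) < decRe x i ^ 2)]
  linarith

lemma rpow_neg_self_le_two {a : ℝ} (ha : 0 < a) (ha1 : a ≤ 1) : a ^ (-a) ≤ 2 := by
  have h1 : -1 ≤ a⁻¹ - 1 := by linarith [inv_pos.mpr ha]
  have h := rpow_one_add_le_one_add_mul_self h1 ha.le ha1
  rw [add_sub_cancel, mul_sub, mul_inv_cancel₀ ha.ne', Real.inv_rpow ha.le] at h
  rw [Real.rpow_neg ha.le]
  linarith

lemma sum_rpow_mul_decRe_le_of_sharpIV_le {n : ℕ} {a t : ℝ} (hn : 3 ≤ n) (ha : 0 < a)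
    (ha2 : a < 1 / 2) (hL : 1 ≤ Real.log n) (ht : 0 ≤ t) {x : Fin n → ℝ}
    (hx : sharpIV n ((1 - a) / 2) (1 + a) x ≤
      20 * (a ^ (-(1 + a) / (2 * a)) * Real.log n ^ (-((1 - 2 * a) / (2 * a))) *
        (n : ℝ) ^ (1 / 2 : ℝ)) + 10 * (√(Real.log n) * t)) :
    ∑ i : Fin n, ((i : ℝ) + 1) ^ (a - 1) * decRe x i ^ (2 * a) ≤
      2000 * a ^ (-(1 : ℝ)) * (n : ℝ) ^ a + 2000 * Real.log n ^ (1 - a) * t ^ (2 * a) := by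
  have hL0 : 0 < Real.log n := by linarith
  have hn0 : (0 : ℝ) < n := by
    have : 0 < n := by omega
    exact_mod_cast this
  set A := a ^ (-(1 + a) / (2 * a)) * Real.log n ^ (-((1 - 2 * a) / (2 * a))) *
    (n : ℝ) ^ (1 / 2 : ℝ) with hA
  have hA0 : 0 ≤ A := by positivity
  have hpow {c : ℝ} (hc : 1 ≤ c) : c ^ (2 * a) ≤ c := by
    have := Real.rpow_le_rpow_of_exponent_le hc (show 2 * a ≤ 1 by linarith)
    rwa [Real.rpow_one] at this
  have hApow : A ^ (2 * a) =
      a ^ (-(1 : ℝ)) * a ^ (-a) * Real.log n ^ (-(1 - 2 * a)) * (n : ℝ) ^ a := by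
    rw [hA, Real.mul_rpow (by positivity) (by positivity),
      Real.mul_rpow (by positivity) (by positivity), ← Real.rpow_mul ha.le,
      ← Real.rpow_mul hL0.le, ← Real.rpow_mul hn0.le, ← Real.rpow_add ha]
    congr 3
    · field_simp
      ring
    · field_simp
    · ring
  have hbound : sharpIV n ((1 - a) / 2) (1 + a) x ^ (2 * a) ≤
      20 * A ^ (2 * a) + 10 * (Real.log n ^ a * t ^ (2 * a)) := by
    calc _ ≤ (20 * A + 10 * (√(Real.log n) * t)) ^ (2 * a) :=
          Real.rpow_le_rpow (sharpIV_nonneg ha x) hx (by positivity)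
      _ ≤ (20 * A) ^ (2 * a) + (10 * (√(Real.log n) * t)) ^ (2 * a) :=
          Real.rpow_add_le_add_rpow (by positivity) (by positivity) (by positivity) (by linarith)
      _ = 20 ^ (2 * a) * A ^ (2 * a) + 10 ^ (2 * a) * (Real.log n ^ a * t ^ (2 * a)) := by
          have hsqrt : √(Real.log n) ^ (2 * a) = Real.log n ^ a := by
            rw [Real.sqrt_eq_rpow, ← Real.rpow_mul hL0.le]
            congr 1
            ring
          rw [Real.mul_rpow (x := 20) (y := A) (by norm_num) hA0,
            Real.mul_rpow (x := 10) (y := √(Real.log n) * t) (by norm_num) (by positivity),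
            Real.mul_rpow (x := √(Real.log n)) (y := t) (by positivity) ht, hsqrt]
      _ ≤ _ := by
          gcongr
          · exact hpow (by norm_num)
          · exact hpow (by norm_num)
  have hLL : Real.log n ^ (1 - 2 * a) * Real.log n ^ (-(1 - 2 * a)) = 1 := by
    rw [← Real.rpow_add hL0, add_neg_cancel, Real.rpow_zero]
  have hLa : Real.log n ^ (1 - 2 * a) * Real.log n ^ a = Real.log n ^ (1 - a) := by
    rw [← Real.rpow_add hL0]
    congr 1
    ring
  calc _ ≤ 42 * Real.log n ^ (1 - 2 * a) * sharpIV n ((1 - a) / 2) (1 + a) x ^ (2 * a) :=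
        sum_rpow_mul_decRe_le hn ha ha2 hL x
    _ ≤ 42 * Real.log n ^ (1 - 2 * a) *
          (20 * A ^ (2 * a) + 10 * (Real.log n ^ a * t ^ (2 * a))) := by gcongr
    _ = 840 * (Real.log n ^ (1 - 2 * a) * Real.log n ^ (-(1 - 2 * a))) * a ^ (-(1 : ℝ)) *
          a ^ (-a) * (n : ℝ) ^ a +
          420 * (Real.log n ^ (1 - 2 * a) * Real.log n ^ a) * t ^ (2 * a) := by
        rw [hApow]
        ring
    _ = 840 * a ^ (-a) * a ^ (-(1 : ℝ)) * (n : ℝ) ^ a +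
          420 * Real.log n ^ (1 - a) * t ^ (2 * a) := by
        rw [hLL, hLa]
        ring
    _ ≤ _ := by
        have := rpow_neg_self_le_two ha (by linarith)
        gcongr ?_ * _ * _ + ?_ * _ * _
        · linarith
        · norm_num

/-- Case IVa: there is a universal constant `C > 0` such that for `n ≥ 3`, `t > 0`,
`r ∈ (1/4, 1/2]`, `p = 2(1-r)` with `(1-2r) ln n ≥ e`, and `X` standard Gaussian in `ℝ^n`:
(i) the coefficients of `|·|_♯` are non-increasing on `1 ≤ i ≤ n/e`;
(ii) `∑ i^{-2r} x_[i]^{2(p-1)} ≤ C (ln n)^{3-2p} |x|_♯^{2(p-1)}` for all `x`;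
(iii) with probability at least `1 - C exp(-t²/2)`,
`|X|_♯ ≤ C^{1/(p-1)} (1-2r)^{-p/(2(p-1))} (ln n)^{-(3-2p)/(2(p-1))} n^{1/2}
  + C^{1/(p-1)} (ln n)^{1/2} t`, and consequently
`∑ i^{-2r} X_[i]^{2(p-1)} ≤ C (1-2r)^{-1} n^{1-2r} + C (ln n)^{2-p} t^{2(p-1)}`. -/
theorem gradient_bound_case_IVa :
    ∃ C : ℝ, 0 < C ∧
      ∀ (n : ℕ) (t r p : ℝ), 3 ≤ n → 0 < t → 1 / 4 < r → r ≤ 1 / 2 →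
        p = 2 * (1 - r) → Real.exp 1 ≤ (1 - 2 * r) * Real.log n →
        (∀ i j : Fin n, i ≤ j → ((j : ℝ) + 1) ≤ (n : ℝ) / Real.exp 1 →
          coeffIV n r p j ≤ coeffIV n r p i) ∧
        (∀ x : Fin n → ℝ,
          ∑ i : Fin n, ((i : ℝ) + 1) ^ (-(2 * r)) * decRe x i ^ (2 * (p - 1)) ≤
            C * Real.log n ^ (3 - 2 * p) * sharpIV n r p x ^ (2 * (p - 1))) ∧
        (1 - C * Real.exp (-t ^ 2 / 2) ≤
          ((stdGaussian n) {x |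
            sharpIV n r p x ≤
              C ^ ((1 : ℝ) / (p - 1)) * (1 - 2 * r) ^ (-p / (2 * (p - 1))) *
                Real.log n ^ (-(3 - 2 * p) / (2 * (p - 1))) * (n : ℝ) ^ ((1 : ℝ) / 2) +
              C ^ ((1 : ℝ) / (p - 1)) * Real.log n ^ ((1 : ℝ) / 2) * t ∧
            (∑ i : Fin n, ((i : ℝ) + 1) ^ (-(2 * r)) * decRe x i ^ (2 * (p - 1))) ≤
              C * (1 - 2 * r) ^ (-(1 : ℝ)) * (n : ℝ) ^ (1 - 2 * r) +
              C * Real.log n ^ (2 - p) * t ^ (2 * (p - 1))}).toReal) := by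
  refine ⟨2000, by norm_num, ?_⟩
  intro n t r p hn ht hr hr2 hp hL
  obtain ⟨a, rfl⟩ : ∃ a, r = (1 - a) / 2 := ⟨1 - 2 * r, by ring⟩
  obtain rfl : p = 1 + a := by rw [hp]; ring
  have e1 : 1 - 2 * ((1 - a) / 2) = a := by ring
  have e2 : -(2 * ((1 - a) / 2)) = a - 1 := by ring
  have e3 : 1 + a - 1 = a := by ring
  have e4 : 3 - 2 * (1 + a) = 1 - 2 * a := by ring
  have e5 : 2 - (1 + a) = 1 - a := by ring
  have e6 : -(1 - 2 * a) / (2 * a) = -((1 - 2 * a) / (2 * a)) := neg_div _ _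
  simp only [e1, e2, e3, e4, e5, e6] at hL ⊢
  have ha2 : a < 1 / 2 := by linarith
  have hlog := Real.log_natCast_nonneg n
  have ha : 0 < a := pos_of_mul_pos_left ((Real.exp_pos 1).trans_le hL) hlog
  have hL1 : 1 ≤ Real.log n := by
    have := Real.add_one_le_exp (1 : ℝ)
    nlinarith
  have hC : 2000 ≤ (2000 : ℝ) ^ (1 / a) := by
    have := Real.rpow_le_rpow_of_exponent_le (x := 2000) (by norm_num)
      (show 1 ≤ 1 / a by rw [le_div_iff₀ ha]; linarith)
    rwa [Real.rpow_one] at this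
  refine ⟨fun i j hij hj => ?_, fun x => ?_, ?_⟩
  · have hij' : (i : ℝ) ≤ j := by exact_mod_cast hij
    exact coeffIV_antitone ha ha2 hij
      (by simp only [overE, Finset.mem_filter_univ]; linarith)
      (by simpa only [overE, Finset.mem_filter_univ] using hj)
  · have := sharpIV_nonneg ha x
    refine (sum_rpow_mul_decRe_le hn ha ha2 hL1 x).trans ?_
    gcongr
    norm_num
  · have h := stdGaussian_subset_sums n t
    have hexp : 1 - 2000 * Real.exp (-t ^ 2 / 2) ≤ 1 - 2 * Real.exp (-t ^ 2 / 2) := by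
      linarith [Real.exp_pos (-t ^ 2 / 2)]
    refine hexp.trans (h.trans (measureReal_mono fun x hx => ?_))
    have hsharp := sharpIV_le ha ha2 hL1 ht.le hx
    refine ⟨hsharp.trans ?_, sum_rpow_mul_decRe_le_of_sharpIV_le hn ha ha2 hL1 ht.le hsharp⟩
    rw [Real.sqrt_eq_rpow, ← mul_assoc, ← mul_assoc, ← mul_assoc]
    gcongr ?_ * _ * _ * _ + ?_ * _ * _ <;> linarith
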